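/- arXiv:1308.5065 — 3 statements merged into one kernel-verified Lean document; each statement's English description precedes it below -/
import Mathlib

section
/- Let (e_j)_{j∈ℕ} and (h_j)_{j∈ℕ} be orthonormal bases of a separable Hilbert space H, let (f_i)_{i∈ℕ} be a sequence in H with Σ_{i∈ℕ} |⟨f_i, e_j⟩|² < ∞ for all j ∈ ℕ, and let (ω_j)_{j∈ℕ} be the R-dual of (f_i) with respect to (e_j) and (h_j). Then for any B > 0, (f_i)_{i∈ℕ} is a Bessel sequence with bound B if and only if (ω_j)_{j∈ℕ} is a Bessel sequence with bound B. -/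
open scoped InnerProductSpace

variable {H : Type*}

/-- `e` is an orthonormal basis of `H`: it is orthonormal and its span is dense. -/
def IsOrthonormalBasisSeq [NormedAddCommGroup H] [InnerProductSpace ℂ H]
    (e : ℕ → H) : Prop :=
  Orthonormal ℂ e ∧ (Submodule.span ℂ (Set.range e)).topologicalClosure = ⊤

/-- `f` is a Bessel sequence with bound `B`. -/
def IsBesselWith [NormedAddCommGroup H] [InnerProductSpace ℂ H]
    {ι : Type*} (f : ι → H) (B : ℝ) : Prop :=
  ∀ x : H, Summable (fun i => ‖⟪x, f i⟫_ℂ‖ ^ 2) ∧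
    ∑' i, ‖⟪x, f i⟫_ℂ‖ ^ 2 ≤ B * ‖x‖ ^ 2

theorem IsOrthonormalBasisSeq.hasSum_norm_inner_sq
    [NormedAddCommGroup H] [InnerProductSpace ℂ H] [CompleteSpace H]
    {h : ℕ → H} (hh : IsOrthonormalBasisSeq h) (z : H) :
    HasSum (fun i => ‖⟪h i, z⟫_ℂ‖ ^ 2) (‖z‖ ^ 2) := by
  have key := (HilbertBasis.mk hh.1 hh.2.ge).hasSum_inner_mul_inner z z
  simp only [HilbertBasis.coe_mk] at key
  rw [← RCLike.hasSum_ofReal (𝕜 := ℂ)]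
  convert key using 1
  · ext i
    rw [← inner_conj_symm z (h i), RCLike.conj_mul]
    simp
  · simp

theorem IsBesselWith.of_inner_eq
    [NormedAddCommGroup H] [InnerProductSpace ℂ H] [CompleteSpace H]
    {e h f ω : ℕ → H} (he : Orthonormal ℂ e) (hh : IsOrthonormalBasisSeq h)
    (hfω : ∀ i j, ⟪h i, ω j⟫_ℂ = ⟪f i, e j⟫_ℂ) {B : ℝ} (hf : IsBesselWith f B) :
    IsBesselWith ω B := by
  intro x
  have bound (s : Finset ℕ) : ∑ j ∈ s, ‖⟪x, ω j⟫_ℂ‖ ^ 2 ≤ B * ‖x‖ ^ 2 := by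
    set S := ∑ j ∈ s, ‖⟪x, ω j⟫_ℂ‖ ^ 2 with hS
    set y := ∑ j ∈ s, ⟪ω j, x⟫_ℂ • e j with hy
    set z := ∑ j ∈ s, ⟪ω j, x⟫_ℂ • ω j with hz
    have hyS : ‖y‖ ^ 2 = S := by
      have := he.inner_sum (fun j => ⟪ω j, x⟫_ℂ) (fun j => ⟪ω j, x⟫_ℂ) s
      rw [← hy, inner_self_eq_norm_sq_to_K] at this
      simp only [RCLike.conj_mul, norm_inner_symm (ω _) x] at this
      exact_mod_cast this
    have hxz : ⟪x, z⟫_ℂ = (S : ℂ) := by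
      rw [hz, inner_sum, hS]
      push_cast
      refine Finset.sum_congr rfl fun j _ => ?_
      rw [inner_smul_right, ← inner_conj_symm (ω j) x, RCLike.conj_mul]
      simp
    have hzy : ‖z‖ ^ 2 ≤ B * S := by
      rw [← hyS, ← (hh.hasSum_norm_inner_sq z).tsum_eq]
      refine le_of_eq_of_le (tsum_congr fun i => ?_) (hf y).2
      rw [norm_inner_symm y (f i)]
      simp only [hz, hy, inner_sum, inner_smul_right, hfω]
    have hS0 : 0 ≤ S := hyS ▸ sq_nonneg _
    have hle : S ≤ ‖x‖ * ‖z‖ := by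
      have := norm_inner_le_norm (𝕜 := ℂ) x z
      rwa [hxz, Complex.norm_of_nonneg hS0] at this
    rcases hS0.eq_or_lt with h0 | h0
    · rw [← h0]
      exact (tsum_nonneg fun i => sq_nonneg _).trans (hf x).2
    · refine le_of_mul_le_mul_right ?_ h0
      calc S * S ≤ (‖x‖ * ‖z‖) * (‖x‖ * ‖z‖) := mul_self_le_mul_self hS0 hle
        _ = ‖x‖ ^ 2 * ‖z‖ ^ 2 := by ring
        _ ≤ ‖x‖ ^ 2 * (B * S) := by gcongr
        _ = B * ‖x‖ ^ 2 * S := by ring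
  exact ⟨summable_of_sum_le (fun _ => sq_nonneg _) bound,
    Real.tsum_le_of_sum_le (fun _ => sq_nonneg _) bound⟩

theorem r_dual_bessel_bound_equivalence
    [NormedAddCommGroup H] [InnerProductSpace ℂ H] [CompleteSpace H]
    [TopologicalSpace.SeparableSpace H]
    (e h : ℕ → H) (he : IsOrthonormalBasisSeq e) (hh : IsOrthonormalBasisSeq h)
    (f : ℕ → H) (hl2 : ∀ j : ℕ, Summable (fun i => ‖⟪f i, e j⟫_ℂ‖ ^ 2))
    (ω : ℕ → H)
    -- `ω` is the R-dual of `f` with respect to `e` and `h`:  ω_j = Σ_i ⟨f_i, e_j⟩ h_i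
    (hω : ∀ j : ℕ, HasSum (fun i => ⟪f i, e j⟫_ℂ • h i) (ω j))
    (B : ℝ) (hB : 0 < B) :
    IsBesselWith f B ↔ IsBesselWith ω B := by
  have hinner (i j : ℕ) : ⟪h i, ω j⟫_ℂ = ⟪f i, e j⟫_ℂ := by
    have key := (hω j).mapL (innerSL ℂ (h i))
    refine key.unique ?_
    convert hasSum_single i fun k hk => ?_ using 1
    · simp [inner_self_eq_norm_sq_to_K, hh.1.1 i]
    · simp [hh.1.2 hk.symm]
  refine ⟨.of_inner_eq he.1 hh hinner, .of_inner_eq hh.1 he fun j i => ?_⟩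
  rw [← inner_conj_symm, ← hinner, inner_conj_symm]
end

section
/- Let (e_j)_{j∈ℕ} and (h_j)_{j∈ℕ} be orthonormal bases of a separable Hilbert space H, let (f_i)_{i∈ℕ} be a sequence in H with Σ_{i∈ℕ} |⟨f_i, e_j⟩|² < ∞ for all j ∈ ℕ, and let (ω_j)_{j∈ℕ} be the R-dual of (f_i) with respect to (e_j) and (h_j). Then for any A, B > 0, (f_i)_{i∈ℕ} is a frame for H with bounds A, B if and only if (ω_j)_{j∈ℕ} is a Riesz sequence in H with bounds A, B. -/
open scoped InnerProductSpace

variable {H : Type*}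

/-- `f` is a frame with bounds `A`, `B`. -/
def IsFrameWith [NormedAddCommGroup H] [InnerProductSpace ℂ H]
    {ι : Type*} (f : ι → H) (A B : ℝ) : Prop :=
  ∀ x : H, Summable (fun i => ‖⟪x, f i⟫_ℂ‖ ^ 2) ∧
    A * ‖x‖ ^ 2 ≤ ∑' i, ‖⟪x, f i⟫_ℂ‖ ^ 2 ∧
    ∑' i, ‖⟪x, f i⟫_ℂ‖ ^ 2 ≤ B * ‖x‖ ^ 2

/-- `f` is a Riesz sequence with bounds `A`, `B`. -/
def IsRieszSeqWith [NormedAddCommGroup H] [InnerProductSpace ℂ H]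
    {ι : Type*} (f : ι → H) (A B : ℝ) : Prop :=
  ∀ (s : Finset ι) (c : ι → ℂ),
    A * ∑ i ∈ s, ‖c i‖ ^ 2 ≤ ‖∑ i ∈ s, c i • f i‖ ^ 2 ∧
    ‖∑ i ∈ s, c i • f i‖ ^ 2 ≤ B * ∑ i ∈ s, ‖c i‖ ^ 2

theorem Orthonormal.norm_sq_sum_smul [NormedAddCommGroup H] [InnerProductSpace ℂ H]
    {ι : Type*} {e : ι → H} (he : Orthonormal ℂ e) (s : Finset ι) (c : ι → ℂ) :
    ‖∑ i ∈ s, c i • e i‖ ^ 2 = ∑ i ∈ s, ‖c i‖ ^ 2 := by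
  have key := inner_self_eq_norm_sq_to_K (𝕜 := ℂ) (∑ i ∈ s, c i • e i)
  rw [he.inner_sum] at key
  simp only [Complex.conj_mul'] at key
  exact Complex.ofReal_injective (by push_cast; exact key.symm)

theorem Orthonormal.hasSum_norm_sq [NormedAddCommGroup H] [InnerProductSpace ℂ H]
    {ι : Type*} {e : ι → H} (he : Orthonormal ℂ e) {a : ι → ℂ} {x : H}
    (hx : HasSum (fun i => a i • e i) x) : HasSum (fun i => ‖a i‖ ^ 2) (‖x‖ ^ 2) :=
  (hx.norm.pow 2).congr fun s => he.norm_sq_sum_smul s a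

/-- The analysis operator of `f` on a finite combination of the `e j` is computed by the R-dual. -/
theorem hasSum_norm_sq_inner_sum_smul [NormedAddCommGroup H] [InnerProductSpace ℂ H]
    {ι κ : Type*} {e ω : κ → H} {h f : ι → H} (hh : Orthonormal ℂ h)
    (hω : ∀ j, HasSum (fun i => ⟪f i, e j⟫_ℂ • h i) (ω j)) (s : Finset κ) (c : κ → ℂ) :
    HasSum (fun i => ‖⟪∑ j ∈ s, c j • e j, f i⟫_ℂ‖ ^ 2) (‖∑ j ∈ s, c j • ω j‖ ^ 2) := by
  have key : HasSum (fun i => ⟪f i, ∑ j ∈ s, c j • e j⟫_ℂ • h i) (∑ j ∈ s, c j • ω j) := by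
    simpa only [inner_sum, inner_smul_right, Finset.sum_smul, mul_smul] using
      hasSum_sum fun j (_ : j ∈ s) => (hω j).const_smul (c j)
  simpa only [norm_inner_symm] using hh.hasSum_norm_sq key

theorem IsFrameWith.of_dense [NormedAddCommGroup H] [InnerProductSpace ℂ H]
    {ι : Type*} {f : ι → H} {A B : ℝ} {S : Set H} (hS : Dense S)
    (hf : ∀ x ∈ S, Summable (fun i => ‖⟪x, f i⟫_ℂ‖ ^ 2) ∧
      A * ‖x‖ ^ 2 ≤ ∑' i, ‖⟪x, f i⟫_ℂ‖ ^ 2 ∧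
      ∑' i, ‖⟪x, f i⟫_ℂ‖ ^ 2 ≤ B * ‖x‖ ^ 2) (hB : 0 ≤ B) : IsFrameWith f A B := by
  have hfin : ∀ (x : H) (t : Finset ι), ∑ i ∈ t, ‖⟪x, f i⟫_ℂ‖ ^ 2 ≤ B * ‖x‖ ^ 2 := by
    intro x t
    have hcl : IsClosed {x : H | ∑ i ∈ t, ‖⟪x, f i⟫_ℂ‖ ^ 2 ≤ B * ‖x‖ ^ 2} :=
      isClosed_le (by fun_prop) (by fun_prop)
    refine hcl.closure_subset_iff.2 (fun y hy => ?_) (hS x)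
    exact ((hf y hy).1.sum_le_tsum t fun i _ => by positivity).trans (hf y hy).2.2
  have hs : ∀ x : H, Summable fun i => ‖⟪x, f i⟫_ℂ‖ ^ 2 := fun x =>
    summable_of_sum_le (fun i => by positivity) (hfin x)
  have hle : ∀ x : H, ∑' i, ‖⟪x, f i⟫_ℂ‖ ^ 2 ≤ B * ‖x‖ ^ 2 := fun x =>
    (hs x).tsum_le_of_sum_le (hfin x)
  let T : H →ₗ[ℂ] lp (fun _ : ι => ℂ) 2 :=
    { toFun := fun x => ⟨fun i => ⟪f i, x⟫_ℂ, memℓp_gen (by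
        simpa [norm_inner_symm] using hs x)⟩
      map_add' := fun x y => by ext i; exact inner_add_right _ _ _
      map_smul' := fun a x => by ext i; exact inner_smul_right _ _ _ }
  have hT : ∀ x, ‖T x‖ ^ 2 = ∑' i, ‖⟪x, f i⟫_ℂ‖ ^ 2 := fun x => by
    have := lp.norm_rpow_eq_tsum (p := 2) (by norm_num) (T x)
    simpa [T, norm_inner_symm] using this
  have hTc : Continuous T := by
    refine (T.mkContinuous (√B) fun x => ?_).continuous
    refine (sq_le_sq₀ (norm_nonneg _) (by positivity)).1 ?_
    rw [hT, mul_pow, Real.sq_sqrt hB]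
    exact hle x
  refine fun x => ⟨hs x, ?_, hle x⟩
  have hcl : IsClosed {x : H | A * ‖x‖ ^ 2 ≤ ‖T x‖ ^ 2} :=
    isClosed_le (by fun_prop) (by fun_prop)
  rw [← hT]
  exact hcl.closure_subset_iff.2 (fun y hy => (hf y hy).2.1.trans_eq (hT y).symm) (hS x)


theorem r_dual_frame_iff_riesz_sequence
    [NormedAddCommGroup H] [InnerProductSpace ℂ H] [CompleteSpace H]
    [TopologicalSpace.SeparableSpace H]
    (e h : ℕ → H) (he : IsOrthonormalBasisSeq e) (hh : IsOrthonormalBasisSeq h)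
    (f : ℕ → H) (hl2 : ∀ j : ℕ, Summable (fun i => ‖⟪f i, e j⟫_ℂ‖ ^ 2))
    (ω : ℕ → H)
    -- `ω` is the R-dual of `f` with respect to `e` and `h`:  ω_j = Σ_i ⟨f_i, e_j⟩ h_i
    (hω : ∀ j : ℕ, HasSum (fun i => ⟪f i, e j⟫_ℂ • h i) (ω j))
    (A B : ℝ) (hA : 0 < A) (hB : 0 < B) :
    IsFrameWith f A B ↔ IsRieszSeqWith ω A B := by
  constructor
  · intro hf s c
    have key := hasSum_norm_sq_inner_sum_smul hh.1 hω s c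
    have hx := hf (∑ j ∈ s, c j • e j)
    rw [key.tsum_eq, he.1.norm_sq_sum_smul] at hx
    exact hx.2
  · intro hr
    refine IsFrameWith.of_dense (Submodule.dense_iff_topologicalClosure_eq_top.2 he.2) ?_ hB.le
    intro x hx
    obtain ⟨c, rfl⟩ := (Finsupp.mem_span_range_iff_exists_finsupp).1 hx
    have key := hasSum_norm_sq_inner_sum_smul hh.1 hω c.support c
    rw [Finsupp.sum, key.tsum_eq, he.1.norm_sq_sum_smul]
    exact ⟨key.summable, hr c.support c⟩
end

section
/- Let (f_k)_{k∈ℕ} be a frame for an infinite-dimensional separable Hilbert space H that is not a Riesz basis (i.e., an overcomplete frame), and assume that every finite subfamily {f_1, …, f_N} is linearly independent. For each N ∈ ℕ let H_N := span{f_1, …, f_N} and let A_N := inf{ Σ_{k=1}^N |⟨f, f_k⟩|² : f ∈ H_N, ‖f‖ = 1 } be the optimal lower frame bound of {f_k}_{k=1}^N as a frame for H_N. Then A_N → 0 as N → ∞. -/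
open scoped InnerProductSpace
open Filter

variable {H : Type*}

/-- `f` is a Riesz basis: the image of an orthonormal basis under a bounded
bijective operator. -/
def IsRieszBasis [NormedAddCommGroup H] [InnerProductSpace ℂ H]
    (f : ℕ → H) : Prop :=
  ∃ e : ℕ → H, IsOrthonormalBasisSeq e ∧
    ∃ U : H →L[ℂ] H, Function.Bijective U ∧ ∀ k, f k = U (e k)

/-- The optimal lower frame bound of the first `N` vectors of `f`, regarded as a
frame for their span `H_N`. -/
noncomputable def finiteLowerBound [NormedAddCommGroup H] [InnerProductSpace ℂ H]
    (f : ℕ → H) (N : ℕ) : ℝ :=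
  sInf {r : ℝ | ∃ x : H, x ∈ Submodule.span ℂ (f '' {k | k < N}) ∧ ‖x‖ = 1 ∧
    r = ∑ k ∈ Finset.range N, ‖⟪x, f k⟫_ℂ‖ ^ 2}

section Analysis

variable [NormedAddCommGroup H] [InnerProductSpace ℂ H]

/-- Any prescribed values of the inner products against a finite linearly independent family
are attained by a vector of its span. -/
theorem LinearIndependent.exists_mem_span_inner_eq {n : ℕ} {g : Fin n → H}
    (hg : LinearIndependent ℂ g) (c : Fin n → ℂ) :
    ∃ x ∈ Submodule.span ℂ (Set.range g), ∀ k, ⟪g k, x⟫_ℂ = c k := by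
  let L : Submodule.span ℂ (Set.range g) →ₗ[ℂ] (Fin n → ℂ) :=
    (LinearMap.pi fun k => (innerSL ℂ (g k)).toLinearMap).comp (Submodule.subtype _)
  have hL : ∀ x k, L x k = ⟪g k, (x : H)⟫_ℂ := fun x k => rfl
  have hinj : Function.Injective L := by
    rw [injective_iff_map_eq_zero]
    intro x hx
    have hperp : ∀ y ∈ Submodule.span ℂ (Set.range g), ⟪y, (x : H)⟫_ℂ = 0 := by
      intro y hy
      induction hy using Submodule.span_induction with
      | mem y hy =>
        obtain ⟨k, rfl⟩ := hy
        rw [← hL, hx]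
        rfl
      | zero => simp
      | add y z _ _ hy hz => rw [inner_add_left, hy, hz, add_zero]
      | smul a y _ hy => rw [inner_smul_left, hy, mul_zero]
    exact Subtype.ext (inner_self_eq_zero.1 (hperp x x.2))
  have hdim : Module.finrank ℂ (Submodule.span ℂ (Set.range g))
      = Module.finrank ℂ (Fin n → ℂ) := by
    rw [finrank_span_eq_card hg, Module.finrank_fintype_fun_eq_card]
  have : FiniteDimensional ℂ (Submodule.span ℂ (Set.range g)) :=
    FiniteDimensional.span_of_finite ℂ (Set.finite_range g)
  obtain ⟨x, hx⟩ := (LinearMap.injective_iff_surjective_of_finrank_eq_finrank hdim).1 hinj c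
  exact ⟨x, x.2, fun k => by rw [← hL, hx]⟩

theorem linearIndependent_of_forall_fin {f : ℕ → H}
    (hli : ∀ N : ℕ, LinearIndependent ℂ (fun k : Fin N => f k)) : LinearIndependent ℂ f := by
  rw [linearIndependent_iff_finset_linearIndependent]
  intro s
  obtain ⟨N, hN⟩ := s.exists_nat_subset_range
  exact (hli N).comp (fun i : s => ⟨i, Finset.mem_range.1 (hN i.2)⟩)
    fun i j hij => Subtype.ext (Fin.mk.inj_iff.1 hij)

theorem finiteLowerBound_nonneg (f : ℕ → H) (N : ℕ) : 0 ≤ finiteLowerBound f N := by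
  refine Real.sInf_nonneg ?_
  rintro r ⟨x, -, -, rfl⟩
  positivity

theorem finiteLowerBound_mul_norm_sq_le (f : ℕ → H) (N : ℕ) {x : H}
    (hx : x ∈ Submodule.span ℂ (f '' {k | k < N})) :
    finiteLowerBound f N * ‖x‖ ^ 2 ≤ ∑ k ∈ Finset.range N, ‖⟪x, f k⟫_ℂ‖ ^ 2 := by
  rcases eq_or_ne x 0 with rfl | hx0
  · simp
  have hpos : 0 < ‖x‖ := norm_pos_iff.2 hx0
  have hle : finiteLowerBound f N
      ≤ ∑ k ∈ Finset.range N, ‖⟪((‖x‖⁻¹ : ℝ) : ℂ) • x, f k⟫_ℂ‖ ^ 2 := by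
    refine csInf_le ⟨0, ?_⟩ ⟨_, Submodule.smul_mem _ _ hx, ?_, rfl⟩
    · rintro r ⟨y, -, -, rfl⟩
      positivity
    · rw [norm_smul, Complex.norm_real, norm_inv, norm_norm, inv_mul_cancel₀ hpos.ne']
  have hsum : ∑ k ∈ Finset.range N, ‖⟪((‖x‖⁻¹ : ℝ) : ℂ) • x, f k⟫_ℂ‖ ^ 2
      = (∑ k ∈ Finset.range N, ‖⟪x, f k⟫_ℂ‖ ^ 2) / ‖x‖ ^ 2 := by
    rw [Finset.sum_div]
    refine Finset.sum_congr rfl fun k _ => ?_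
    rw [inner_smul_left, norm_mul, RCLike.norm_conj, Complex.norm_real, norm_inv, norm_norm]
    field_simp
  rw [hsum, le_div_iff₀ (by positivity)] at hle
  exact hle

/-- The optimal lower frame bound of a finite linearly independent family is also a
lower Riesz bound. -/
theorem finiteLowerBound_mul_sum_norm_sq_le {f : ℕ → H} {N : ℕ}
    (hli : LinearIndependent ℂ (fun k : Fin N => f k)) (c : ℕ → ℂ) :
    finiteLowerBound f N * ∑ k ∈ Finset.range N, ‖c k‖ ^ 2
      ≤ ‖∑ k ∈ Finset.range N, c k • f k‖ ^ 2 := by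
  obtain ⟨x, hx, hxc⟩ := hli.exists_mem_span_inner_eq fun k => c k
  have hset : Set.range (fun k : Fin N => f k) = f '' {k | k < N} := by
    ext y
    constructor
    · rintro ⟨k, rfl⟩
      exact ⟨k, k.2, rfl⟩
    · rintro ⟨k, hk, rfl⟩
      exact ⟨⟨k, hk⟩, rfl⟩
  rw [hset] at hx
  have hxc' : ∀ k ∈ Finset.range N, ⟪f k, x⟫_ℂ = c k := fun k hk =>
    hxc ⟨k, Finset.mem_range.1 hk⟩
  have hlow := finiteLowerBound_mul_norm_sq_le f N hx
  have hcoef : ∑ k ∈ Finset.range N, ‖⟪x, f k⟫_ℂ‖ ^ 2 = ∑ k ∈ Finset.range N, ‖c k‖ ^ 2 :=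
    Finset.sum_congr rfl fun k hk => by rw [norm_inner_symm, hxc' k hk]
  rw [hcoef] at hlow
  set S := ∑ k ∈ Finset.range N, ‖c k‖ ^ 2 with hS
  set y := ∑ k ∈ Finset.range N, c k • f k with hy
  have hinner : ⟪y, x⟫_ℂ = (S : ℂ) := by
    rw [hy, hS, sum_inner]
    push_cast
    refine Finset.sum_congr rfl fun k hk => ?_
    rw [inner_smul_left, hxc' k hk, Complex.conj_mul']
  have hS0 : 0 ≤ S := by positivity
  have hCS : S ≤ ‖y‖ * ‖x‖ := by
    have := norm_inner_le_norm (𝕜 := ℂ) y x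
    rwa [hinner, Complex.norm_real, Real.norm_of_nonneg hS0] at this
  rcases hS0.eq_or_lt with h0 | hpos
  · rw [← h0, mul_zero]
    positivity
  have ha := finiteLowerBound_nonneg f N
  refine le_of_mul_le_mul_right ?_ hpos
  calc finiteLowerBound f N * S * S = finiteLowerBound f N * S ^ 2 := by ring
    _ ≤ finiteLowerBound f N * (‖y‖ * ‖x‖) ^ 2 := by gcongr
    _ = ‖y‖ ^ 2 * (finiteLowerBound f N * ‖x‖ ^ 2) := by ring
    _ ≤ ‖y‖ ^ 2 * S := by gcongr

theorem IsFrameWith.eq_zero_of_forall_inner_eq_zero {ι : Type*} {f : ι → H} {A B : ℝ}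
    (hf : IsFrameWith f A B) (hA : 0 < A) {x : H} (hx : ∀ i, ⟪x, f i⟫_ℂ = 0) : x = 0 := by
  have h := (hf x).2.1
  simp only [hx, norm_zero, ne_eq, OfNat.ofNat_ne_zero, not_false_eq_true, zero_pow,
    tsum_zero] at h
  have : ‖x‖ ^ 2 ≤ 0 := by
    by_contra! hlt
    exact absurd h (not_le.2 (mul_pos hA hlt))
  simpa using this

theorem IsFrameWith.closure_span_eq_top [CompleteSpace H] {ι : Type*} {f : ι → H} {A B : ℝ}
    (hf : IsFrameWith f A B) (hA : 0 < A) :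
    (Submodule.span ℂ (Set.range f)).topologicalClosure = ⊤ := by
  rw [Submodule.topologicalClosure_eq_top_iff, Submodule.eq_bot_iff]
  intro x hx
  refine hf.eq_zero_of_forall_inner_eq_zero hA fun i => ?_
  exact (Submodule.mem_orthogonal' _ _).1 hx _ (Submodule.subset_span ⟨i, rfl⟩)

/-- The synthesis operator of a frame. -/
theorem IsFrameWith.exists_synthesis [CompleteSpace H] {f : ℕ → H} {A B : ℝ}
    (hf : IsFrameWith f A B) :
    ∃ T : lp (fun _ : ℕ => ℂ) 2 →L[ℂ] H, ∀ k a, T (lp.single 2 k a) = a • f k := by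
  have hmem : ∀ x : H, Memℓp (fun k => ⟪f k, x⟫_ℂ) 2 := fun x => by
    refine memℓp_gen ?_
    simpa [norm_inner_symm x] using (hf x).1
  let C₀ : H →ₗ[ℂ] lp (fun _ : ℕ => ℂ) 2 :=
    { toFun := fun x => ⟨fun k => ⟪f k, x⟫_ℂ, hmem x⟩
      map_add' := fun x y => by
        ext k
        exact inner_add_right _ _ _
      map_smul' := fun a x => by
        ext k
        exact inner_smul_right _ _ _ }
  have hC₀ : ∀ x k, C₀ x k = ⟪f k, x⟫_ℂ := fun x k => rfl
  have hbound : ∀ x, ‖C₀ x‖ ≤ Real.sqrt B * ‖x‖ := fun x => by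
    have h := lp.norm_rpow_eq_tsum (p := 2) (by norm_num) (C₀ x)
    simp only [hC₀, norm_inner_symm _ x, ENNReal.toReal_ofNat, Real.rpow_ofNat] at h
    rw [← Real.sqrt_sq (norm_nonneg x), ← Real.sqrt_mul' _ (sq_nonneg _)]
    refine Real.le_sqrt_of_sq_le ?_
    rw [h]
    exact (hf x).2.2
  let C := C₀.mkContinuous _ hbound
  refine ⟨ContinuousLinearMap.adjoint C, fun k a => ext_inner_right ℂ fun x => ?_⟩
  rw [ContinuousLinearMap.adjoint_inner_left, lp.inner_single_left, inner_smul_left]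
  change ⟪a, ⟪f k, x⟫_ℂ⟫_ℂ = _
  simp [mul_comm]

/-- A frame with linearly independent finite sections which is bounded below as a Riesz
sequence is a Riesz basis. -/
theorem IsFrameWith.isRieszBasis [CompleteSpace H] {f : ℕ → H} {A B ε : ℝ}
    (hf : IsFrameWith f A B) (hA : 0 < A) (hli : LinearIndependent ℂ f) (hε : 0 < ε)
    (hlow : ∀ (c : ℕ → ℂ) (N : ℕ), ε * ∑ k ∈ Finset.range N, ‖c k‖ ^ 2
      ≤ ‖∑ k ∈ Finset.range N, c k • f k‖ ^ 2) : IsRieszBasis f := by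
  obtain ⟨T, hT⟩ := hf.exists_synthesis
  have hdense := hf.closure_span_eq_top hA
  have hTlow : ∀ c, ε * ‖c‖ ^ 2 ≤ ‖T c‖ ^ 2 := fun c => by
    have h₁ : HasSum (fun k => ‖c k‖ ^ 2) (‖c‖ ^ 2) := by
      simpa using lp.hasSum_norm (p := 2) (by norm_num) c
    have h₂ : HasSum (fun k => c k • f k) (T c) := by
      simpa only [hT] using T.hasSum (lp.hasSum_single (by norm_num) c)
    exact le_of_tendsto_of_tendsto' (h₁.tendsto_sum_nat.const_mul ε)
      (h₂.tendsto_sum_nat.norm.pow 2) (hlow c)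
  have hanti : AntilipschitzWith (Real.toNNReal (Real.sqrt ε⁻¹)) T := by
    refine T.antilipschitz_of_bound fun c => ?_
    rw [Real.coe_toNNReal _ (Real.sqrt_nonneg _), ← Real.sqrt_sq (norm_nonneg (T c)),
      ← Real.sqrt_mul' _ (sq_nonneg _)]
    refine Real.le_sqrt_of_sq_le ?_
    rw [inv_mul_eq_div, le_div_iff₀ hε, mul_comm]
    exact hTlow c
  have hsurj : Function.Surjective T := by
    have hclosed : IsClosed (T.range : Set H) := by
      rw [LinearMap.coe_range]
      exact hanti.isClosed_range T.uniformContinuous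
    have hle : Submodule.span ℂ (Set.range f) ≤ T.range := by
      rw [Submodule.span_le]
      rintro _ ⟨k, rfl⟩
      exact ⟨lp.single 2 k 1, by simpa using hT k 1⟩
    have htop : T.range = ⊤ :=
      top_le_iff.1 (hdense ▸ Submodule.topologicalClosure_minimal _ hle hclosed)
    exact LinearMap.range_eq_top.1 htop
  have horth : Orthonormal ℂ (InnerProductSpace.gramSchmidtNormed ℂ f) :=
    InnerProductSpace.gramSchmidtNormed_orthonormal hli
  have hspan : (Submodule.span ℂ
      (Set.range (InnerProductSpace.gramSchmidtNormed ℂ f))).topologicalClosure = ⊤ := by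
    rw [InnerProductSpace.span_gramSchmidtNormed_range, InnerProductSpace.span_gramSchmidt, hdense]
  let b := HilbertBasis.mk horth hspan.ge
  refine ⟨b, ?_, T.comp (b.repr.toContinuousLinearEquiv : H →L[ℂ] lp (fun _ : ℕ => ℂ) 2), ?_, ?_⟩
  · exact ⟨b.orthonormal, b.dense_span⟩
  · have hbij : Function.Bijective T := ⟨hanti.injective, hsurj⟩
    exact hbij.comp b.repr.bijective
  · intro k
    change f k = T (b.repr (b k))
    rw [b.repr_self, hT, one_smul]

end Analysis

theorem lower_frame_bounds_of_finite_sections_tend_to_zero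
    [NormedAddCommGroup H] [InnerProductSpace ℂ H] [CompleteSpace H]
    [TopologicalSpace.SeparableSpace H]
    (hinf : ¬ FiniteDimensional ℂ H)
    (f : ℕ → H) (hframe : ∃ A > 0, ∃ B > 0, IsFrameWith f A B)
    (hover : ¬ IsRieszBasis f)
    (hli : ∀ N : ℕ, LinearIndependent ℂ (fun k : Fin N => f k)) :
    Tendsto (fun N => finiteLowerBound f N) atTop (nhds 0) := by
  obtain ⟨A, hA, B, -, hf⟩ := hframe
  rw [Metric.tendsto_atTop]
  by_contra! hnot
  obtain ⟨ε, hε, hfreq⟩ := hnot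
  refine hover (hf.isRieszBasis hA (linearIndependent_of_forall_fin hli) hε fun c N => ?_)
  obtain ⟨M, hNM, hM⟩ := hfreq N
  rw [Real.dist_eq, sub_zero, abs_of_nonneg (finiteLowerBound_nonneg f M)] at hM
  let d : ℕ → ℂ := fun k => if k ∈ Finset.range N then c k else 0
  have hsub : Finset.range N ⊆ Finset.range M := Finset.range_subset_range.2 hNM
  have h₁ : ∑ k ∈ Finset.range M, ‖d k‖ ^ 2 = ∑ k ∈ Finset.range N, ‖c k‖ ^ 2 := by
    rw [← Finset.sum_subset hsub fun k _ hk => by simp only [d, if_neg hk]; simp]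
    exact Finset.sum_congr rfl fun k hk => by simp only [d, if_pos hk]
  have h₂ : ∑ k ∈ Finset.range M, d k • f k = ∑ k ∈ Finset.range N, c k • f k := by
    rw [← Finset.sum_subset hsub fun k _ hk => by simp only [d, if_neg hk, zero_smul]]
    exact Finset.sum_congr rfl fun k hk => by simp only [d, if_pos hk]
  have hriesz := finiteLowerBound_mul_sum_norm_sq_le (hli M) d
  rw [h₁, h₂] at hriesz
  exact le_trans (by gcongr) hriesz
end
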